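/- Let p be a prime, k ≥ 2 an integer, and E = (Z_p)^k a non-cyclic elementary Abelian p-group. Then β(E) < |E|^{0.8}. Furthermore, if |E| is not equal to 2², 3², or 5², then β(E) < |E|^{0.67}. -/

import Mathlib

/-!  Definition of the Noether number `β(G)` of a group `G`, over the field `ℂ`
(of characteristic 0).  A finite-dimensional `ℂG`-module is (up to isomorphism)
given by a representation `ρ : Representation ℂ G (Fin n → ℂ)`; the algebra of
polynomial invariants is realised inside `MvPolynomial (Fin n) ℂ` as the
common equalizer of the substitution maps induced by the group elements. -/

/-- The algebra endomorphism of the polynomial ring induced by the linear action of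
`g : G` on the underlying space (substitution of the variables by linear forms). -/
noncomputable def Representation.polySubst {G : Type*} [Group G] {n : ℕ}
    (ρ : Representation ℂ G (Fin n → ℂ)) (g : G) :
    MvPolynomial (Fin n) ℂ →ₐ[ℂ] MvPolynomial (Fin n) ℂ :=
  MvPolynomial.aeval fun i =>
    ∑ j, MvPolynomial.C (LinearMap.toMatrix' (ρ g) i j) * MvPolynomial.X j

/-- The subalgebra of `G`-invariant polynomials. -/
noncomputable def Representation.invariantAlgebra {G : Type*} [Group G] {n : ℕ}
    (ρ : Representation ℂ G (Fin n → ℂ)) : Subalgebra ℂ (MvPolynomial (Fin n) ℂ) :=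
  ⨅ g : G, AlgHom.equalizer (ρ.polySubst g) (AlgHom.id ℂ (MvPolynomial (Fin n) ℂ))

/-- The invariant algebra is generated by its elements of (total) degree at most `d`. -/
def Representation.InvariantsGeneratedInDegree {G : Type*} [Group G] {n : ℕ}
    (ρ : Representation ℂ G (Fin n → ℂ)) (d : ℕ) : Prop :=
  Algebra.adjoin ℂ {f : MvPolynomial (Fin n) ℂ | f ∈ ρ.invariantAlgebra ∧ f.totalDegree ≤ d}
    = ρ.invariantAlgebra

/-- The Noether number `β(G)`: the smallest degree bound `d` such that for every
finite-dimensional `ℂG`-module the algebra of polynomial invariants is generated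
by its elements of degree at most `d`.  (Equivalently, the maximum over all
finite-dimensional modules `V` of the minimal generating degree `β(G,V)`.) -/
noncomputable def noetherNumber (G : Type*) [Group G] : ℕ :=
  sInf {d : ℕ | ∀ (n : ℕ) (ρ : Representation ℂ G (Fin n → ℂ)),
    ρ.InvariantsGeneratedInDegree d}

/-- The Noether index `n(G) = |G| / β(G)`, as a real number. -/
noncomputable def noetherIndex (G : Type*) [Group G] : ℝ :=
  (Nat.card G : ℝ) / (noetherNumber G : ℝ)

open MvPolynomial in
/-- **Olson's theorem** for elementary abelian groups: any family of more than `k * (p - 1)`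
vectors of `(ZMod p)^k` has a nonempty subfamily with sum zero. -/
theorem exists_nonempty_sum_eq_zero {p k : ℕ} [Fact p.Prime] {ι : Type*} [Fintype ι]
    (a : ι → Fin k → ZMod p) (h : k * (p - 1) < Fintype.card ι) :
    ∃ S : Finset ι, S.Nonempty ∧ ∑ i ∈ S, a i = 0 := by
  classical
  have hp : p.Prime := Fact.out
  have hp1 : p - 1 ≠ 0 := by have := hp.two_le; omega
  let f : Fin k → MvPolynomial ι (ZMod p) := fun j => ∑ i, C (a i j) * X i ^ (p - 1)
  have hf : ∀ j, (f j).totalDegree ≤ p - 1 := fun j =>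
    totalDegree_finsetSum_le fun i _ => by
      refine (totalDegree_mul _ _).trans ?_
      rw [totalDegree_C, totalDegree_X_pow, zero_add]
  have hsum : ∑ j, (f j).totalDegree < Fintype.card ι :=
    (Finset.sum_le_sum fun j _ => hf j).trans_lt (by simpa using h)
  have hzero : ∀ j ∈ Finset.univ, eval (0 : ι → ZMod p) (f j) = 0 := fun j _ => by
    simp [f, hp1]
  have hcard : 1 < Fintype.card {x : ι → ZMod p // ∀ j ∈ Finset.univ, eval x (f j) = 0} :=
    hp.one_lt.trans_le (Nat.le_of_dvd (Fintype.card_pos_iff.2 ⟨⟨0, hzero⟩⟩)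
      (by convert char_dvd_card_solutions_of_sum_lt p hsum))
  obtain ⟨⟨x, hx⟩, hne⟩ := Fintype.exists_ne_of_one_lt_card hcard ⟨0, hzero⟩
  have hx0 : x ≠ 0 := fun h0 => hne (Subtype.ext h0)
  obtain ⟨i₀, hi₀⟩ := Function.ne_iff.1 hx0
  refine ⟨Finset.univ.filter fun i => x i ≠ 0, ⟨i₀, by simpa using hi₀⟩, ?_⟩
  ext j
  have hj := hx j (Finset.mem_univ j)
  simp only [f, map_sum, map_mul, eval_C, map_pow, eval_X] at hj
  rw [Finset.sum_apply, Pi.zero_apply, Finset.sum_filter]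
  refine (Finset.sum_congr rfl fun i _ => ?_).trans hj
  split_ifs with hi
  · rw [ZMod.pow_card_sub_one_eq_one hi, mul_one]
  · rw [not_not.1 hi, zero_pow hp1, mul_zero]

/-- Multiset form of `exists_nonempty_sum_eq_zero`, with control on the size of the zero-sum
submultiset. -/
theorem Multiset.exists_le_sum_map_eq_zero {p k : ℕ} [Fact p.Prime] {I : Type*}
    (v : I → Fin k → ZMod p) (s : Multiset I) (hs : k * (p - 1) + 1 ≤ card s) :
    ∃ t ≤ s, t ≠ 0 ∧ card t ≤ k * (p - 1) + 1 ∧ (t.map v).sum = 0 := by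
  obtain ⟨u, hus, hu⟩ : ∃ u ≤ s, card u = k * (p - 1) + 1 := by
    induction s using Quotient.inductionOn with
    | _ l => exact ⟨l.take (k * (p - 1) + 1), Multiset.coe_le.2 (l.take_sublist _).subperm,
        by simpa using hs⟩
  induction u using Quotient.inductionOn with
  | _ l =>
    obtain ⟨S, hS, hsum⟩ := exists_nonempty_sum_eq_zero (fun i : Fin l.length => v (l.get i))
      (by simpa using (show k * (p - 1) < l.length by simp at hu; omega))
    have hle : S.val.map l.get ≤ (l : Multiset I) := by
      calc S.val.map l.get ≤ (Finset.univ : Finset (Fin l.length)).val.map l.get :=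
            Multiset.map_le_map (Finset.val_le_iff.2 (Finset.subset_univ S))
        _ = l := by simp
    refine ⟨S.val.map l.get, hle.trans hus, ?_, ?_, ?_⟩
    · simpa using hS.ne_empty
    · exact (Multiset.card_le_card hle).trans hu.le
    · rw [Multiset.map_map]
      exact hsum

/-- A product of zero weight lies in any subalgebra containing the zero-weight products with at
most `k * (p - 1) + 1` factors. -/
theorem Subalgebra.multiset_prod_mem_of_sum_map_eq_zero {p k : ℕ} [Fact p.Prime] {I R B : Type*}
    [CommSemiring R] [CommSemiring B] [Algebra R B] (A : Subalgebra R B) (v : I → Fin k → ZMod p)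
    (y : I → B)
    (hA : ∀ s : Multiset I, s.card ≤ k * (p - 1) + 1 → (s.map v).sum = 0 → (s.map y).prod ∈ A)
    (s : Multiset I) (hs : (s.map v).sum = 0) : (s.map y).prod ∈ A := by
  classical
  induction s using Multiset.strongInductionOn with
  | _ s ih =>
    rcases le_total s.card (k * (p - 1) + 1) with h | h
    · exact hA s h hs
    · obtain ⟨t, hts, ht0, htc, htv⟩ := s.exists_le_sum_map_eq_zero v h
      obtain ⟨u, rfl⟩ := Multiset.le_iff_exists_add.1 hts
      rw [Multiset.map_add, Multiset.sum_add, htv, zero_add] at hs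
      rw [Multiset.map_add, Multiset.prod_add]
      refine A.mul_mem (hA t htc htv) (ih u ?_ hs)
      exact lt_of_le_of_ne (Multiset.le_add_left _ _) fun h => ht0 (by simpa using h.symm)

/-- Orthogonality relation for the characters `w ↦ ψ (w ⬝ᵥ g)` of `(ZMod p)^k`. -/
theorem sum_stdAddChar_dotProduct {p k : ℕ} [NeZero p] (g : Fin k → ZMod p) :
    ∑ w : Fin k → ZMod p, ZMod.stdAddChar (w ⬝ᵥ g) = if g = 0 then (p : ℂ) ^ k else 0 := by
  classical
  have h1 : ∀ w : Fin k → ZMod p,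
      (ZMod.stdAddChar (w ⬝ᵥ g) : ℂ) = ∏ i, ZMod.stdAddChar (w i * g i) := fun w => by
    exact map_prod ZMod.stdAddChar.toMonoidHom (fun i => Multiplicative.ofAdd (w i * g i)) _
  have h2 : ∀ b : ZMod p,
      ∑ x, (ZMod.stdAddChar (x * b) : ℂ) = if b = 0 then (p : ℂ) else 0 := fun b => by
    rw [AddChar.sum_mulShift b (ZMod.isPrimitive_stdAddChar p), ZMod.card]
    split_ifs <;> simp
  simp_rw [h1]
  rw [← Fintype.prod_sum (fun i x => (ZMod.stdAddChar (x * g i) : ℂ))]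
  simp_rw [h2]
  split_ifs with hg
  · simp [hg]
  · obtain ⟨i, hi⟩ := Function.ne_iff.1 hg
    exact Finset.prod_eq_zero (Finset.mem_univ i) (if_neg hi)

namespace Representation

open MvPolynomial

variable {G : Type*} [Group G] {n : ℕ} (ρ : Representation ℂ G (Fin n → ℂ))

theorem mem_invariantAlgebra {f : MvPolynomial (Fin n) ℂ} :
    f ∈ ρ.invariantAlgebra ↔ ∀ g, ρ.polySubst g f = f := by
  simp [invariantAlgebra, Algebra.mem_iInf, AlgHom.mem_equalizer]

theorem polySubst_X (g : G) (i : Fin n) :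
    ρ.polySubst g (X i) = ∑ j, C (LinearMap.toMatrix' (ρ g) i j) * X j := by
  simp [polySubst]

theorem polySubst_one (f : MvPolynomial (Fin n) ℂ) : ρ.polySubst 1 f = f := by
  have h : ρ.polySubst 1 = AlgHom.id ℂ _ := by
    ext1 i
    rw [polySubst_X, map_one, Module.End.one_eq_id, LinearMap.toMatrix'_id]
    simp [Matrix.one_apply]
  rw [h, AlgHom.id_apply]

theorem polySubst_polySubst (g h : G) (f : MvPolynomial (Fin n) ℂ) :
    ρ.polySubst g (ρ.polySubst h f) = ρ.polySubst (h * g) f := by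
  have H : (ρ.polySubst g).comp (ρ.polySubst h) = ρ.polySubst (h * g) := by
    ext1 i
    simp only [AlgHom.comp_apply, polySubst_X, map_sum, map_mul, LinearMap.toMatrix'_mul,
      Matrix.mul_apply, Finset.sum_mul, Finset.mul_sum, algHom_C, algebraMap_eq]
    rw [Finset.sum_comm]
    simp only [mul_assoc]
  exact DFunLike.congr_fun H f

theorem totalDegree_polySubst_X_le (g : G) (i : Fin n) :
    (ρ.polySubst g (X i)).totalDegree ≤ 1 := by
  rw [polySubst_X]
  refine totalDegree_finsetSum_le fun j _ => (totalDegree_mul _ _).trans ?_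
  rw [totalDegree_C, totalDegree_X]

end Representation

section ElementaryAbelian

open MvPolynomial

variable {p k n : ℕ} [NeZero p]
  (ρ : Representation ℂ (Multiplicative (Fin k → ZMod p)) (Fin n → ℂ))

/-- The component of the `i`-th variable on which `(ZMod p)^k` acts through the character
`g ↦ ψ (w ⬝ᵥ g)`. -/
noncomputable def Representation.weightComponent (x : Fin n × (Fin k → ZMod p)) :
    MvPolynomial (Fin n) ℂ :=
  ((p : ℂ) ^ k)⁻¹ • ∑ g : Fin k → ZMod p,
    (ZMod.stdAddChar (x.2 ⬝ᵥ (-g)) : ℂ) • ρ.polySubst (Multiplicative.ofAdd g) (X x.1)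

theorem Representation.sum_weightComponent (i : Fin n) :
    ∑ w, ρ.weightComponent (i, w) = X i := by
  have hp : ((p : ℂ) ^ k) ≠ 0 := pow_ne_zero _ (NeZero.ne _)
  simp only [weightComponent]
  rw [← Finset.smul_sum, Finset.sum_comm]
  simp_rw [← Finset.sum_smul, sum_stdAddChar_dotProduct, neg_eq_zero, ite_smul, zero_smul]
  rw [Finset.sum_ite_eq' Finset.univ 0, if_pos (Finset.mem_univ _), ofAdd_zero, polySubst_one,
    inv_smul_smul₀ hp]

theorem Representation.polySubst_weightComponent (h : Fin k → ZMod p)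
    (x : Fin n × (Fin k → ZMod p)) :
    ρ.polySubst (Multiplicative.ofAdd h) (ρ.weightComponent x) =
      (ZMod.stdAddChar (x.2 ⬝ᵥ h) : ℂ) • ρ.weightComponent x := by
  simp only [weightComponent, map_smul, map_sum, polySubst_polySubst, ← ofAdd_add]
  rw [smul_comm]
  congr 1
  rw [Finset.smul_sum]
  refine Fintype.sum_equiv (Equiv.addRight h) _ _ fun g => ?_
  rw [smul_smul, ← AddChar.map_add_eq_mul, ← dotProduct_add, Equiv.coe_addRight, neg_add,
    add_comm (-g), add_neg_cancel_left]

theorem Representation.totalDegree_weightComponent_le (x : Fin n × (Fin k → ZMod p)) :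
    (ρ.weightComponent x).totalDegree ≤ 1 :=
  (totalDegree_smul_le _ _).trans <| totalDegree_finsetSum_le fun _ _ =>
    (totalDegree_smul_le _ _).trans (ρ.totalDegree_polySubst_X_le _ _)

theorem Representation.polySubst_prod_weightComponent (h : Fin k → ZMod p)
    (s : Multiset (Fin n × (Fin k → ZMod p))) :
    ρ.polySubst (Multiplicative.ofAdd h) (s.map ρ.weightComponent).prod =
      (ZMod.stdAddChar ((s.map Prod.snd).sum ⬝ᵥ h) : ℂ) • (s.map ρ.weightComponent).prod := by
  induction s using Multiset.induction_on with
  | empty => simp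
  | cons x s ih =>
    rw [Multiset.map_cons, Multiset.prod_cons, map_mul, ih, polySubst_weightComponent,
      Multiset.map_cons, Multiset.sum_cons, add_dotProduct, AddChar.map_add_eq_mul,
      smul_mul_smul_comm]

theorem Representation.sum_polySubst_prod_weightComponent
    (s : Multiset (Fin n × (Fin k → ZMod p))) :
    ∑ h, ρ.polySubst (Multiplicative.ofAdd h) (s.map ρ.weightComponent).prod =
      (if (s.map Prod.snd).sum = 0 then (p : ℂ) ^ k else 0) •
        (s.map ρ.weightComponent).prod := by
  simp_rw [polySubst_prod_weightComponent, ← Finset.sum_smul, dotProduct_comm _,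
    sum_stdAddChar_dotProduct]

/-- Every polynomial is a polynomial in the weight components of the variables. -/
theorem Representation.aeval_weightComponent_surjective :
    Function.Surjective (aeval (R := ℂ) ρ.weightComponent) := fun f => by
  refine ⟨aeval (fun i => ∑ w, X (i, w)) f, ?_⟩
  have h : (aeval ρ.weightComponent).comp (aeval (R := ℂ) fun i => ∑ w, X (i, w)) =
      AlgHom.id ℂ (MvPolynomial (Fin n) ℂ) := by
    ext1 i
    simp [sum_weightComponent]
  exact DFunLike.congr_fun h f

theorem Representation.sum_polySubst_mem [Fact p.Prime] (f : MvPolynomial (Fin n) ℂ) :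
    ∑ h, ρ.polySubst (Multiplicative.ofAdd h) f ∈
      Algebra.adjoin ℂ {f : MvPolynomial (Fin n) ℂ |
        f ∈ ρ.invariantAlgebra ∧ f.totalDegree ≤ k * (p - 1) + 1} := by
  obtain ⟨F, rfl⟩ := ρ.aeval_weightComponent_surjective f
  induction F using MvPolynomial.induction_on' with
  | add F₁ F₂ h₁ h₂ =>
    simp only [map_add, Finset.sum_add_distrib]
    exact add_mem h₁ h₂
  | monomial m c =>
    have hm : aeval ρ.weightComponent (monomial m c) =
        c • ((Finsupp.toMultiset m).map ρ.weightComponent).prod := by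
      rw [aeval_monomial, Finsupp.toMultiset_map, Finsupp.prod_toMultiset, Algebra.smul_def,
        Finsupp.prod_mapDomain_index (by simp) (by simp [pow_add])]
    simp only [hm, map_smul, ← Finset.smul_sum]
    rw [sum_polySubst_prod_weightComponent]
    refine Subalgebra.smul_mem _ ?_ _
    split_ifs with h0
    · refine Subalgebra.smul_mem _ ?_ _
      refine Subalgebra.multiset_prod_mem_of_sum_map_eq_zero _ Prod.snd _ (fun s hs hs0 => ?_) _ h0
      refine Algebra.subset_adjoin ⟨ρ.mem_invariantAlgebra.2 fun g => ?_, ?_⟩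
      · have := ρ.polySubst_prod_weightComponent g.toAdd s
        rwa [hs0, zero_dotProduct, AddChar.map_zero_eq_one, one_smul, ofAdd_toAdd] at this
      · refine (totalDegree_multiset_prod _).trans (le_trans ?_ hs)
        rw [Multiset.map_map]
        refine (Multiset.sum_le_card_nsmul _ 1 ?_).trans (by simp)
        simp only [Multiset.mem_map]
        rintro _ ⟨x, -, rfl⟩
        exact ρ.totalDegree_weightComponent_le x
    · rw [zero_smul]
      exact Subalgebra.zero_mem _

theorem Representation.invariantsGeneratedInDegree [Fact p.Prime] :
    ρ.InvariantsGeneratedInDegree (k * (p - 1) + 1) := by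
  refine le_antisymm (Algebra.adjoin_le fun f hf => hf.1) fun f hf => ?_
  have hp : ((p : ℂ) ^ k) ≠ 0 := pow_ne_zero _ (NeZero.ne _)
  have h := ρ.sum_polySubst_mem f
  simp only [ρ.mem_invariantAlgebra.1 hf] at h
  rw [Finset.sum_const, Finset.card_univ, Fintype.card_fun, ZMod.card, Fintype.card_fin,
    ← Nat.cast_smul_eq_nsmul ℂ, Nat.cast_pow] at h
  simpa [smul_smul, inv_mul_cancel₀ hp] using Subalgebra.smul_mem _ h ((p : ℂ) ^ k)⁻¹

end ElementaryAbelian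

theorem noetherNumber_elementary_abelian_le (p k : ℕ) [Fact p.Prime] :
    noetherNumber (Multiplicative (Fin k → ZMod p)) ≤ k * (p - 1) + 1 :=
  Nat.sInf_le fun _ ρ => ρ.invariantsGeneratedInDegree

theorem mul_sub_one_add_one_pow_three_le {p k : ℕ} (hp : 2 ≤ p) (hk : 3 ≤ k) :
    (k * (p - 1) + 1) ^ 3 ≤ (p ^ k) ^ 2 := by
  obtain ⟨q, rfl⟩ : ∃ q, p = q + 1 := ⟨p - 1, by omega⟩
  rw [Nat.add_sub_cancel]
  induction k, hk using Nat.le_induction with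
  | base =>
    have h : 3 * q + 1 ≤ (q + 1) ^ 2 := by nlinarith
    calc (3 * q + 1) ^ 3 ≤ ((q + 1) ^ 2) ^ 3 := Nat.pow_le_pow_left h 3
      _ = ((q + 1) ^ 3) ^ 2 := by ring
  | succ k hk ih =>
    have h : 3 * ((k + 1) * q + 1) ≤ 4 * (k * q + 1) := by nlinarith
    have h3 := Nat.pow_le_pow_left h 3
    have h4 : 2 ^ 2 ≤ (q + 1) ^ 2 := Nat.pow_le_pow_left hp 2
    rw [mul_pow, mul_pow] at h3
    calc ((k + 1) * q + 1) ^ 3 ≤ 2 ^ 2 * (k * q + 1) ^ 3 := by omega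
      _ ≤ (q + 1) ^ 2 * ((q + 1) ^ k) ^ 2 := Nat.mul_le_mul h4 ih
      _ = ((q + 1) ^ (k + 1)) ^ 2 := by ring

theorem two_mul_sub_one_add_one_pow_three_le {p : ℕ} (hp : 7 ≤ p) :
    (2 * (p - 1) + 1) ^ 3 ≤ (p ^ 2) ^ 2 := by
  rcases hp.eq_or_lt with rfl | hp
  · norm_num
  · calc (2 * (p - 1) + 1) ^ 3 ≤ (2 * p) ^ 3 := Nat.pow_le_pow_left (by omega) 3
      _ = 8 * p ^ 3 := by ring
      _ ≤ p * p ^ 3 := Nat.mul_le_mul_right _ hp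
      _ = (p ^ 2) ^ 2 := by ring

theorem Real.natCast_le_rpow_div_of_pow_le {m q a b : ℕ} (hb : b ≠ 0) (h : m ^ b ≤ q ^ a) :
    (m : ℝ) ≤ (q : ℝ) ^ ((a : ℝ) / b) := by
  rw [div_eq_mul_inv, Real.rpow_mul q.cast_nonneg, Real.rpow_natCast]
  refine (Real.le_rpow_inv_iff_of_pos m.cast_nonneg (by positivity) (by positivity)).2 ?_
  rw [Real.rpow_natCast]
  exact_mod_cast h

/-- **Lemma (Olson, consequences).**  For a non-cyclic elementary abelian `p`-group
`E = (Z_p)^k` (`k ≥ 2`) we have `β(E) < |E|^0.8`; moreover if `|E| ∉ {2², 3², 5²}`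
then `β(E) < |E|^0.67`. -/
theorem noetherNumber_elementary_abelian_lt
    (p k : ℕ) (hp : p.Prime) (hk : 2 ≤ k) :
    (noetherNumber (Multiplicative (Fin k → ZMod p)) : ℝ) <
      (Nat.card (Multiplicative (Fin k → ZMod p)) : ℝ) ^ (0.8 : ℝ) ∧
    (Nat.card (Multiplicative (Fin k → ZMod p)) ≠ 2 ^ 2 →
     Nat.card (Multiplicative (Fin k → ZMod p)) ≠ 3 ^ 2 →
     Nat.card (Multiplicative (Fin k → ZMod p)) ≠ 5 ^ 2 →
      (noetherNumber (Multiplicative (Fin k → ZMod p)) : ℝ) <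
        (Nat.card (Multiplicative (Fin k → ZMod p)) : ℝ) ^ (0.67 : ℝ)) := by
  have : Fact p.Prime := ⟨hp⟩
  have hcard : Nat.card (Multiplicative (Fin k → ZMod p)) = p ^ k := by
    rw [Nat.card_congr Multiplicative.toAdd]
    simp
  have hβ : (noetherNumber (Multiplicative (Fin k → ZMod p)) : ℝ) ≤ (k * (p - 1) + 1 : ℕ) :=
    Nat.cast_le.2 (noetherNumber_elementary_abelian_le p k)
  have hq : (1 : ℝ) < (p ^ k : ℕ) := by exact_mod_cast Nat.one_lt_pow (by omega) hp.one_lt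
  rw [hcard]
  have key : ∀ a b : ℕ, b ≠ 0 → (k * (p - 1) + 1) ^ b ≤ (p ^ k) ^ a → ∀ e : ℝ, (a : ℝ) / b < e →
      (noetherNumber (Multiplicative (Fin k → ZMod p)) : ℝ) < ((p ^ k : ℕ) : ℝ) ^ e :=
    fun a b hb h e he => (hβ.trans (Real.natCast_le_rpow_div_of_pow_le hb h)).trans_lt
      (Real.rpow_lt_rpow_of_exponent_lt hq he)
  by_cases h : k = 2 ∧ p < 7
  · obtain ⟨rfl, h7⟩ := h
    have hsmall : ∀ q < 7, q.Prime → q = 2 ∨ q = 3 ∨ q = 5 := by decide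
    obtain rfl | rfl | rfl := hsmall p h7 hp
    · exact ⟨key 23 29 (by norm_num) (by norm_num) _ (by norm_num), fun h => absurd rfl h⟩
    · exact ⟨key 3 4 (by norm_num) (by norm_num) _ (by norm_num), fun _ h => absurd rfl h⟩
    · exact ⟨key 3 4 (by norm_num) (by norm_num) _ (by norm_num), fun _ _ h => absurd rfl h⟩
  · have hmain : (k * (p - 1) + 1) ^ 3 ≤ (p ^ k) ^ 2 := by
      rcases hk.eq_or_lt with rfl | hk
      · exact two_mul_sub_one_add_one_pow_three_le (by omega)
      · exact mul_sub_one_add_one_pow_three_le hp.two_le hk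
    exact ⟨key 2 3 (by norm_num) hmain _ (by norm_num),
      fun _ _ _ => key 2 3 (by norm_num) hmain _ (by norm_num)⟩
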